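/- (Interior Lipschitz bound.) Let u be a classical solution of the regularized problem, and suppose there is a nondecreasing K : (0,T] → (0,∞) with ∂_t u(t,x) ≥ −(u(t,x) + 1/n)/K(t) for all (t,x) ∈ (0,T] × (a,b). Fix 0 < t₀ ≤ T, a < d₁ ≤ d₂ < b, and 0 < r ≤ min(d₁ − a, b − d₂), set N = 1/(K(t₀)·ρ_λ(a)) + sup_{x∈(a,b)} |g(x)|, and let B₀ ≥ u(t,x) for all t ∈ [t₀,T] and x ∈ (d₁ − r, d₂ + r). Then for all t ∈ [t₀,T] and x ∈ [d₁,d₂], |∂_x u(t,x)| ≤ 2·B₀/r + (N/2)·r. -/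

import Mathlib

open MeasureTheory Set

noncomputable def rho (lam x : ℝ) : ℝ := Real.sqrt x * (x + lam) * Real.sqrt (x + 2 * lam)

/-- `u` is a classical solution of the regularized Dirichlet problem on `[0,T] × [a,b]`:
nonnegative, continuous, C¹ in time, C² in space, solving
`∂ₜu = ρ_λ(x)(u + 1/n)∂ₓ²u + ρ_λ(x) g(x) (u + 1/n)` with zero lateral boundary data
and initial data `u₀`. -/
structure IsRegSolution (lam a b T : ℝ) (n : ℕ) (g u₀ : ℝ → ℝ) (u : ℝ → ℝ → ℝ) : Prop where
  nonneg : ∀ t ∈ Icc (0:ℝ) T, ∀ x ∈ Icc a b, 0 ≤ u t x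
  cont : ContinuousOn (fun p : ℝ × ℝ => u p.1 p.2) (Icc (0:ℝ) T ×ˢ Icc a b)
  diff_t : ∀ t ∈ Icc (0:ℝ) T, ∀ x ∈ Icc a b, DifferentiableAt ℝ (fun s => u s x) t
  diff_x : ∀ t ∈ Icc (0:ℝ) T, ∀ x ∈ Icc a b, DifferentiableAt ℝ (fun y => u t y) x
  diff_xx : ∀ t ∈ Icc (0:ℝ) T, ∀ x ∈ Icc a b, DifferentiableAt ℝ (deriv (fun y => u t y)) x
  cont_dt : ContinuousOn (fun p : ℝ × ℝ => deriv (fun s => u s p.2) p.1) (Icc (0:ℝ) T ×ˢ Icc a b)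
  cont_dx : ContinuousOn (fun p : ℝ × ℝ => deriv (fun y => u p.1 y) p.2) (Icc (0:ℝ) T ×ˢ Icc a b)
  cont_dxx : ContinuousOn (fun p : ℝ × ℝ => deriv (deriv (fun y => u p.1 y)) p.2) (Icc (0:ℝ) T ×ˢ Icc a b)
  eqn : ∀ t ∈ Icc (0:ℝ) T, ∀ x ∈ Ioo a b,
    deriv (fun s => u s x) t =
      rho lam x * (u t x + 1 / (n:ℝ)) * deriv (deriv (fun y => u t y)) x
        + rho lam x * g x * (u t x + 1 / (n:ℝ))
  bdry_a : ∀ t ∈ Icc (0:ℝ) T, u t a = 0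
  bdry_b : ∀ t ∈ Icc (0:ℝ) T, u t b = 0
  init : ∀ x ∈ Icc a b, u 0 x = u₀ x

/-- The weight `rho lam` is positive on `(0, ∞)`. -/
lemma rho_pos {lam x : ℝ} (hlam : 0 ≤ lam) (hx : 0 < x) : 0 < rho lam x := by
  unfold rho
  have := Real.sqrt_pos.2 hx
  have : 0 < Real.sqrt (x + 2 * lam) := Real.sqrt_pos.2 (by linarith)
  positivity

/-- The weight `rho lam` is nondecreasing on `(0, ∞)`. -/
lemma rho_le_rho {lam x y : ℝ} (hlam : 0 ≤ lam) (hx : 0 < x) (hxy : x ≤ y) :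
    rho lam x ≤ rho lam y := by
  unfold rho
  have : 0 ≤ y + lam := by linarith
  gcongr

/-- A function whose second derivative is at least `-N` lies above its tangents, up to the
quadratic error `N / 2 * (y - x) ^ 2`. -/
lemma tangent_sub_sq_le {f : ℝ → ℝ} {a b N x y : ℝ}
    (hf : ∀ z ∈ Ioo a b, DifferentiableAt ℝ f z)
    (hf' : ∀ z ∈ Ioo a b, DifferentiableAt ℝ (deriv f) z)
    (hN : ∀ z ∈ Ioo a b, -N ≤ deriv (deriv f) z) (hx : x ∈ Ioo a b) (hy : y ∈ Ioo a b) :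
    f x + deriv f x * (y - x) - N / 2 * (y - x) ^ 2 ≤ f y := by
  have h1 : ∀ z ∈ Ioo a b,
      HasDerivAt (fun z => f z + N / 2 * z ^ 2) (deriv f z + N * z) z := fun z hz => by
    have := (hf z hz).hasDerivAt.add (((hasDerivAt_id z).pow 2).const_mul (N / 2))
    refine this.congr_deriv ?_
    simp only [id]
    push_cast
    ring
  have h2 : ∀ z ∈ Ioo a b,
      HasDerivAt (fun z => deriv f z + N * z) (deriv (deriv f) z + N) z := fun z hz => by
    exact ((hf' z hz).hasDerivAt.add ((hasDerivAt_id z).const_mul N)).congr_deriv (by simp)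
  have hconv : ConvexOn ℝ (Ioo a b) (fun z => f z + N / 2 * z ^ 2) := by
    refine convexOn_of_hasDerivWithinAt2_nonneg (convex_Ioo a b)
      (fun z hz => (h1 z hz).continuousAt.continuousWithinAt)
      (fun z hz => (h1 z (interior_subset hz)).hasDerivWithinAt)
      (fun z hz => (h2 z (interior_subset hz)).hasDerivWithinAt) fun z hz => ?_
    linarith [hN z (interior_subset hz)]
  rcases lt_trichotomy x y with h | rfl | h
  · have := hconv.le_slope_of_hasDerivAt hx hy h (h1 x hx)
    rw [slope_def_field, le_div_iff₀ (sub_pos.2 h)] at this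
    linarith
  · simp
  · have := hconv.slope_le_of_hasDerivAt hy hx h (h1 x hx)
    rw [slope_def_field, div_le_iff₀ (sub_pos.2 h)] at this
    linarith

/-- Interior Lipschitz bound: with a nondecreasing `K > 0` satisfying the
Benilan–Crandall inequality, `0 < r ≤ min(d₁-a, b-d₂)`,
`N = 1/(K(t₀)ρ_λ(a)) + sup_{(a,b)}|g|`, and `B₀ ≥ u` on `[t₀,T] × (d₁-r, d₂+r)`,
one has `|∂ₓu(t,x)| ≤ 2B₀/r + (N/2)r` on `[t₀,T] × [d₁,d₂]`. -/
theorem interior_lipschitz_bound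
    (lam a b T : ℝ) (n : ℕ) (hlam : 0 ≤ lam) (ha : 0 < a) (hab : a < b) (hT : 0 < T)
    (hn : 1 ≤ n) (g u₀ : ℝ → ℝ) (hg : ContinuousOn g (Icc a b))
    (hgbdd : BddAbove ((fun x => |g x|) '' Ioo a b))
    (hu₀c : ContinuousOn u₀ (Icc a b)) (hu₀nn : ∀ x ∈ Icc a b, 0 ≤ u₀ x)
    (hu₀a : u₀ a = 0) (hu₀b : u₀ b = 0)
    (u : ℝ → ℝ → ℝ) (hu : IsRegSolution lam a b T n g u₀ u)
    (K : ℝ → ℝ) (hKpos : ∀ t ∈ Ioc (0:ℝ) T, 0 < K t) (hKmono : MonotoneOn K (Ioc 0 T))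
    (hBC : ∀ t ∈ Ioc (0:ℝ) T, ∀ x ∈ Ioo a b,
      deriv (fun s => u s x) t ≥ -((u t x + 1 / (n:ℝ)) / K t))
    (t₀ d₁ d₂ r N Mg B₀ : ℝ) (ht₀ : 0 < t₀) (ht₀T : t₀ ≤ T)
    (hd₁ : a < d₁) (hd₁₂ : d₁ ≤ d₂) (hd₂ : d₂ < b)
    (hrpos : 0 < r) (hr : r ≤ min (d₁ - a) (b - d₂))
    (hMg : IsLUB ((fun x => |g x|) '' Ioo a b) Mg)
    (hN : N = 1 / (K t₀ * rho lam a) + Mg)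
    (hB₀ : ∀ t ∈ Icc t₀ T, ∀ x ∈ Ioo (d₁ - r) (d₂ + r), u t x ≤ B₀) :
    ∀ t ∈ Icc t₀ T, ∀ x ∈ Icc d₁ d₂,
      |deriv (fun y => u t y) x| ≤ 2 * B₀ / r + (N / 2) * r := by
  intro t ht x hx
  have ht' : t ∈ Icc 0 T := ⟨ht₀.le.trans ht.1, ht.2⟩
  have ht'' : t ∈ Ioc 0 T := ⟨ht₀.trans_le ht.1, ht.2⟩
  have hK₀ : 0 < K t₀ := hKpos t₀ ⟨ht₀, ht₀T⟩
  have hKle : K t₀ ≤ K t := hKmono ⟨ht₀, ht₀T⟩ ht'' ht.1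
  have hρa := rho_pos hlam ha
  have hr₁ : r ≤ d₁ - a := hr.trans (min_le_left _ _)
  have hr₂ : r ≤ b - d₂ := hr.trans (min_le_right _ _)
  have hxab : x ∈ Ioo a b := ⟨hd₁.trans_le hx.1, hx.2.trans_lt hd₂⟩
  have hMg0 : 0 ≤ Mg := (abs_nonneg (g x)).trans (hMg.1 ⟨x, hxab, rfl⟩)
  have hN0 : 0 ≤ N := by rw [hN]; positivity
  have hlow : ∀ z ∈ Ioo a b, -N ≤ deriv (deriv (fun y => u t y)) z := fun z hz => by
    have hρz := rho_le_rho hlam ha hz.1.le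
    have hρz0 : 0 < rho lam z := hρa.trans_le hρz
    have hpos : 0 < u t z + 1 / (n : ℝ) :=
      add_pos_of_nonneg_of_pos (hu.nonneg t ht' z (Ioo_subset_Icc_self hz)) (by positivity)
    have hgz : g z ≤ Mg := (le_abs_self _).trans (hMg.1 ⟨z, hz, rfl⟩)
    have hbc := hBC t ht'' z hz
    rw [hu.eqn t ht' z hz] at hbc
    set w := u t z + 1 / (n : ℝ)
    set D := deriv (deriv (fun y => u t y)) z
    have hKt : 0 < K t := hKpos t ht''
    have hdiv : -(1 / (K t * rho lam z)) ≤ D + g z := by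
      have : -(1 / (K t * rho lam z)) * (rho lam z * w) ≤ (D + g z) * (rho lam z * w) := by
        have he : -(1 / (K t * rho lam z)) * (rho lam z * w) = -(w / K t) := by
          field_simp
        rw [he]
        linarith
      exact le_of_mul_le_mul_right this (by positivity)
    have hle : 1 / (K t * rho lam z) ≤ 1 / (K t₀ * rho lam a) := by gcongr
    linarith
  have htan := fun y (hy : y ∈ Ioo a b) => tangent_sub_sq_le (f := fun y => u t y)
    (fun z hz => hu.diff_x t ht' z (Ioo_subset_Icc_self hz))
    (fun z hz => hu.diff_xx t ht' z (Ioo_subset_Icc_self hz)) hlow hxab hy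
  have hux := hu.nonneg t ht' x (Ioo_subset_Icc_self hxab)
  have hup := htan (x + r / 2) ⟨by linarith [hx.1], by linarith [hx.2]⟩
  have hdown := htan (x - r / 2) ⟨by linarith [hx.1], by linarith [hx.2]⟩
  have hBup := hB₀ t ht (x + r / 2) ⟨by linarith [hx.1], by linarith [hx.2]⟩
  have hBdown := hB₀ t ht (x - r / 2) ⟨by linarith [hx.1], by linarith [hx.2]⟩
  have hNr : 0 ≤ N * r ^ 2 := by positivity
  have hrhs : 2 * B₀ / r + N / 2 * r = (2 * B₀ + N / 2 * r ^ 2) / r := by field_simp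
  rw [hrhs, le_div_iff₀ hrpos, ← abs_of_pos hrpos, ← abs_mul, abs_of_pos hrpos, abs_le]
  constructor <;> nlinarith
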